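/- Let P be holomorphic on an open set U ⊆ ℂ with P'(y) ≠ 0 for all y ∈ U and mapping U bijectively onto an open set V; identify ℂ with ℝ². Define the matrix field A : V → M₂(ℝ) by A_{kj}(x) = (∂_j P^k)(P⁻¹(x)) (the real Jacobian of P evaluated at P⁻¹(x), where P = (P¹,P²)) and Q²(x) = |P'(P⁻¹(x))|². Then for each i ∈ {1,2}, the vector field x ↦ (A_{1i}(x)/Q²(x), A_{2i}(x)/Q²(x)) is divergence-free on V, i.e. Σ_k ∂_k (A_{ki}/Q²)(x) = 0 for all x ∈ V. -/

import Mathlib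

/-- The two coordinate directions of `ℂ ≃ ℝ²`. -/
noncomputable def dirC : Fin 2 → ℂ := ![1, Complex.I]

/-- `j`-th partial derivative of a real-valued function on `ℂ ≃ ℝ²`. -/
noncomputable def pd (f : ℂ → ℝ) (j : Fin 2) (x : ℂ) : ℝ :=
  fderiv ℝ f x (dirC j)

/-- `k`-th real coordinate of a complex number (`k = 0`: real part, `k = 1`: imaginary part). -/
noncomputable def coordC (k : Fin 2) (w : ℂ) : ℝ := ![w.re, w.im] k

/-- The matrix field `A k j x = (∂_j P^k)(P⁻¹ x)`. -/
noncomputable def jacA (P Pinv : ℂ → ℂ) (k j : Fin 2) (x : ℂ) : ℝ :=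
  pd (fun z => coordC k (P z)) j (Pinv x)

/-- The conformal factor `Q²(x) = |P'(P⁻¹ x)|²`. -/
noncomputable def Qsq (P Pinv : ℂ → ℂ) (x : ℂ) : ℝ :=
  ‖deriv P (Pinv x)‖ ^ 2

open scoped Topology ComplexConjugate

/-- A real-linear functional applied to a holomorphic function has partial derivatives given by
the complex derivative. -/
lemma pd_clm_comp_of_hasDerivAt (L : ℂ →L[ℝ] ℝ) {f : ℂ → ℂ} {f' x : ℂ}
    (hf : HasDerivAt f f' x) (j : Fin 2) :
    pd (fun z => L (f z)) j x = L (f' * dirC j) := by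
  have h := (L.hasFDerivAt.comp x (hf.hasFDerivAt.restrictScalars ℝ)).fderiv
  have h' : (fun z => L (f z)) = L ∘ f := rfl
  rw [pd, h', h]
  simp [mul_comm]

/-- The complex conjugate of a holomorphic function is divergence free. -/
lemma sum_pd_coordC_conj_eq_zero {f : ℂ → ℂ} {f' x : ℂ} (hf : HasDerivAt f f' x) :
    ∑ k : Fin 2, pd (fun z => coordC k (conj (f z))) k x = 0 := by
  have h0 := pd_clm_comp_of_hasDerivAt Complex.reCLM hf 0
  have h1 := pd_clm_comp_of_hasDerivAt (-Complex.imCLM) hf 1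
  simp only [Fin.sum_univ_two, coordC, Matrix.cons_val_zero, Matrix.cons_val_one,
    Complex.conj_re, Complex.conj_im]
  simp only [Complex.reCLM_apply, neg_apply, Complex.imCLM_apply] at h0 h1
  rw [h0, h1]
  simp [dirC]

/-- The columns of `A / Q²` are the conjugates of holomorphic functions. -/
lemma jacA_div_Qsq {P Pinv : ℂ → ℂ} {x : ℂ} (hP : DifferentiableAt ℂ P (Pinv x)) (k i : Fin 2) :
    jacA P Pinv k i x / Qsq P Pinv x =
      coordC k (conj ((deriv P (Pinv x))⁻¹ * conj (dirC i))) := by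
  have hre := pd_clm_comp_of_hasDerivAt Complex.reCLM hP.hasDerivAt i
  have him := pd_clm_comp_of_hasDerivAt Complex.imCLM hP.hasDerivAt i
  simp only [Complex.reCLM_apply, Complex.imCLM_apply] at hre him
  fin_cases k
  · simp only [jacA, coordC, Qsq, Fin.zero_eta, Matrix.cons_val_zero, hre,
      ← Complex.normSq_eq_norm_sq]
    simp only [map_mul, Complex.conj_conj, Complex.mul_re, Complex.conj_re, Complex.conj_im,
      Complex.inv_re, Complex.inv_im]
    ring
  · simp only [jacA, coordC, Qsq, Fin.mk_one, Matrix.cons_val_one, Matrix.cons_val_fin_one, him,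
      ← Complex.normSq_eq_norm_sq]
    simp only [map_mul, Complex.conj_conj, Complex.mul_im, Complex.conj_re, Complex.conj_im,
      Complex.inv_re, Complex.inv_im]
    ring

/-- For a conformal bijection `P : U → V` with inverse `Pinv`, each column
`i` of `A/Q²` is divergence free on `V`: `∑ k, ∂_k (A_{ki}/Q²) = 0`. -/
theorem stmt_4 (U V : Set ℂ) (hU : IsOpen U) (hV : IsOpen V)
    (P Pinv : ℂ → ℂ)
    (hP : ∀ y ∈ U, DifferentiableAt ℂ P y)
    (hP' : ∀ y ∈ U, deriv P y ≠ 0)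
    (hbij : Set.BijOn P U V)
    (hinv : Set.InvOn Pinv P U V) :
    ∀ i : Fin 2, ∀ x ∈ V,
      ∑ k : Fin 2, pd (fun y => jacA P Pinv k i y / Qsq P Pinv y) k x = 0 := by
  intro i x hx
  obtain ⟨y, hy, rfl⟩ := hbij.surjOn hx
  have hPan : AnalyticAt ℂ P y :=
    DifferentiableOn.analyticAt (fun z hz => (hP z hz).differentiableWithinAt) (hU.mem_nhds hy)
  have hleft : ∀ᶠ z in 𝓝 y, Pinv (P z) = z := by
    filter_upwards [hU.mem_nhds hy] with z hz using hinv.1 hz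
  have hPinv := (hPan.hasStrictDerivAt.to_local_left_inverse (hP' y hy) hleft).hasDerivAt
  have hyx : Pinv (P y) = y := hinv.1 hy
  have hg : DifferentiableAt ℂ (fun w => (deriv P (Pinv w))⁻¹ * conj (dirC i)) (P y) := by
    refine (DifferentiableAt.inv ?_ ?_).mul_const _
    · refine DifferentiableAt.comp (g := deriv P) (P y) ?_ hPinv.differentiableAt
      rw [hyx]
      exact hPan.deriv.differentiableAt
    · rw [hyx]
      exact hP' y hy
  rw [← sum_pd_coordC_conj_eq_zero hg.hasDerivAt]
  refine Finset.sum_congr rfl fun k _ => ?_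
  have heq : (fun w => jacA P Pinv k i w / Qsq P Pinv w) =ᶠ[𝓝 (P y)]
      fun w => coordC k (conj ((deriv P (Pinv w))⁻¹ * conj (dirC i))) := by
    filter_upwards [hV.mem_nhds hx] with w hw
    obtain ⟨z, hz, rfl⟩ := hbij.surjOn hw
    exact jacA_div_Qsq (by rw [hinv.1 hz]; exact hP z hz) k i
  rw [pd, pd, heq.fderiv_eq]
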